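/- Let $(X_1, C_1, u_1)$ and $(X_2, C_2, u_2)$ be order unit spaces with strictly positive states $\varphi_1, \varphi_2$ and cross sections $\Sigma_i = \{x \in C_i^\circ : \varphi_i(x) = 1\}$, each equipped with Hilbert's metric $d_H$. Suppose $\Sigma_1$ and $\Sigma_2$ are strictly convex, i.e., for all $x, y$ in the relative boundary of $\Sigma_i$ the open segment $(x, y)$ is contained in $\Sigma_i$. Then every isometry $f : (\Sigma_1, d_H) \to (\Sigma_2, d_H)$ is a projective linear homomorphism: there exists a bi-positive linear map $T : X_1 \to X_2$ such that $f(x) = Tx / \varphi_2(Tx)$ for all $x \in \Sigma_1$. -/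

import Mathlib

namespace HilbertGeom

/-- An order unit space: a real vector space with an Archimedean cone `C` and order unit `u`. -/
structure OrderUnitSpace (X : Type*) [AddCommGroup X] [Module ℝ X] where
  C : Set X
  u : X
  convex : Convex ℝ C
  smul_mem : ∀ ⦃c : ℝ⦄, 0 ≤ c → ∀ ⦃x : X⦄, x ∈ C → c • x ∈ C
  salient : ∀ ⦃x : X⦄, x ∈ C → -x ∈ C → x = 0
  archimedean : ∀ x y : X, y ∈ C → (∀ n : ℕ, 0 < n → y - (n : ℝ) • x ∈ C) → -x ∈ C
  u_mem : u ∈ C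
  orderUnit : ∀ x : X, ∃ c : ℝ, 0 < c ∧ c • u - x ∈ C

namespace OrderUnitSpace

variable {X : Type*} [AddCommGroup X] [Module ℝ X] (S : OrderUnitSpace X)

/-- The order unit norm `‖x‖_u = inf {c > 0 : -c•u ≤ x ≤ c•u}`. -/
noncomputable def onorm (x : X) : ℝ :=
  sInf {c : ℝ | 0 < c ∧ c • S.u - x ∈ S.C ∧ c • S.u + x ∈ S.C}

/-- The interior of the cone `C` with respect to the order unit norm. -/
def interiorC : Set X :=
  {x : X | ∃ ε > 0, ∀ y : X, S.onorm (y - x) < ε → y ∈ S.C}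

/-- `M(x/y) = inf {β > 0 : x ≤_C β y}`. -/
noncomputable def M (x y : X) : ℝ := sInf {c : ℝ | 0 < c ∧ c • y - x ∈ S.C}

/-- Birkhoff's version of Hilbert's metric. -/
noncomputable def dH (x y : X) : ℝ := Real.log (S.M x y * S.M y x)

/-- `φ` is a state: a linear functional with `φ u = 1`. -/
def IsState (φ : X →ₗ[ℝ] ℝ) : Prop := φ S.u = 1

/-- `φ` is strictly positive: `φ(C \ {0}) ⊆ (0, ∞)`. -/
def StrictlyPos (φ : X →ₗ[ℝ] ℝ) : Prop := ∀ x ∈ S.C, x ≠ 0 → 0 < φ x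

/-- The cross section `Σ_φ = {x ∈ C° : φ x = 1}`. -/
def Sig (φ : X →ₗ[ℝ] ℝ) : Set X := {x | x ∈ S.interiorC ∧ φ x = 1}

/-- `z` lies in the closure of `A` with respect to the order unit norm. -/
def InClosure (A : Set X) (z : X) : Prop := ∀ ε > 0, ∃ w ∈ A, S.onorm (w - z) < ε

/-- The relative boundary of `Σ_φ` (in the affine hyperplane `φ = 1`, w.r.t. the order
unit norm): since `Σ_φ` is relatively open this is its closure minus itself. -/
def relBoundary (φ : X →ₗ[ℝ] ℝ) : Set X :=
  {z : X | S.InClosure (S.Sig φ) z ∧ z ∉ S.Sig φ}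

/-- The straight line through `x` and `y`. -/
def lineThrough (x y : X) : Set X := {z : X | ∃ t : ℝ, z = x + t • (y - x)}

end OrderUnitSpace

end HilbertGeom

namespace HilbertGeom

open OrderUnitSpace

namespace OrderUnitSpace

variable {X : Type*} [AddCommGroup X] [Module ℝ X] (S : OrderUnitSpace X)

lemma zero_mem : (0 : X) ∈ S.C := by
  simpa using S.smul_mem le_rfl S.u_mem

lemma add_mem {x y : X} (hx : x ∈ S.C) (hy : y ∈ S.C) : x + y ∈ S.C := by
  have h := S.smul_mem (by norm_num : (0 : ℝ) ≤ 2)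
    (S.convex hx hy (by norm_num : (0 : ℝ) ≤ 1 / 2) (by norm_num : (0 : ℝ) ≤ 1 / 2) (by norm_num))
  convert h using 1
  module

lemma mem_of_smul_mem {c : ℝ} (hc : 0 < c) {x : X} (h : c • x ∈ S.C) : x ∈ S.C := by
  simpa [smul_smul, hc.ne'] using S.smul_mem (inv_nonneg.2 hc.le) h

lemma mem_of_forall_add_smul_unit {w : X} (h : ∀ ε > (0 : ℝ), w + ε • S.u ∈ S.C) : w ∈ S.C := by
  have := S.archimedean (-w) S.u S.u_mem (fun n hn => by
    have hn' : (0 : ℝ) < n := by exact_mod_cast hn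
    have h1 := S.smul_mem hn'.le (h (n : ℝ)⁻¹ (by positivity))
    convert h1 using 1
    rw [smul_add, smul_smul, mul_inv_cancel₀ hn'.ne']
    module)
  simpa using this

lemma exists_add_mem (x : X) : ∃ c : ℝ, 0 < c ∧ c • S.u + x ∈ S.C := by
  obtain ⟨c, hc, h⟩ := S.orderUnit (-x)
  exact ⟨c, hc, by simpa using h⟩

lemma onorm_le {x : X} {c : ℝ} (hc : 0 < c) (h₁ : c • S.u - x ∈ S.C) (h₂ : c • S.u + x ∈ S.C) :
    S.onorm x ≤ c :=
  csInf_le ⟨0, fun _ h => h.1.le⟩ ⟨hc, h₁, h₂⟩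

lemma exists_onorm_bound (x : X) :
    ∃ c : ℝ, 0 < c ∧ c • S.u - x ∈ S.C ∧ c • S.u + x ∈ S.C := by
  obtain ⟨c, hc, h⟩ := S.orderUnit x
  obtain ⟨d, hd, h'⟩ := S.exists_add_mem x
  refine ⟨c + d, by positivity, ?_, ?_⟩
  · convert S.add_mem h (S.smul_mem hd.le S.u_mem) using 1
    module
  · convert S.add_mem h' (S.smul_mem hc.le S.u_mem) using 1
    module

lemma mem_interiorC_iff {x : X} : x ∈ S.interiorC ↔ ∃ ε > (0 : ℝ), x - ε • S.u ∈ S.C := by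
  constructor
  · rintro ⟨ε, hε, h⟩
    refine ⟨ε / 2, by positivity, h _ ?_⟩
    refine (S.onorm_le (c := ε / 2) (by positivity) ?_ ?_).trans_lt (by linarith)
    · convert S.smul_mem hε.le S.u_mem using 1
      module
    · convert S.zero_mem using 1
      module
  · rintro ⟨ε, hε, h⟩
    refine ⟨ε, hε, fun y hy => ?_⟩
    obtain ⟨c, ⟨hc, -, h₂⟩, hcε⟩ := exists_lt_of_csInf_lt (S.exists_onorm_bound (y - x)) hy
    convert S.add_mem h (S.add_mem h₂ (S.smul_mem (sub_nonneg.2 hcε.le) S.u_mem)) using 1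
    module

lemma interiorC_subset {x : X} (hx : x ∈ S.interiorC) : x ∈ S.C := by
  obtain ⟨ε, hε, h⟩ := S.mem_interiorC_iff.1 hx
  convert S.add_mem h (S.smul_mem hε.le S.u_mem) using 1
  module

lemma interiorC_add {x y : X} (hx : x ∈ S.interiorC) (hy : y ∈ S.C) : x + y ∈ S.interiorC := by
  obtain ⟨ε, hε, h⟩ := S.mem_interiorC_iff.1 hx
  refine S.mem_interiorC_iff.2 ⟨ε, hε, ?_⟩
  convert S.add_mem h hy using 1
  module

lemma interiorC_smul {x : X} {c : ℝ} (hc : 0 < c) (hx : x ∈ S.interiorC) :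
    c • x ∈ S.interiorC := by
  obtain ⟨ε, hε, h⟩ := S.mem_interiorC_iff.1 hx
  refine S.mem_interiorC_iff.2 ⟨c * ε, by positivity, ?_⟩
  convert S.smul_mem hc.le h using 1
  module

lemma unit_mem_interiorC : S.u ∈ S.interiorC := by
  refine S.mem_interiorC_iff.2 ⟨1, one_pos, ?_⟩
  simpa using S.zero_mem

/-- An interior element absorbs a small multiple of any vector. -/
lemma exists_add_smul_mem {x : X} (hx : x ∈ S.interiorC) (v : X) :
    ∃ δ > (0 : ℝ), x + δ • v ∈ S.C := by
  obtain ⟨ε, hε, h⟩ := S.mem_interiorC_iff.1 hx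
  obtain ⟨K, hK, h'⟩ := S.exists_add_mem v
  refine ⟨ε / K, by positivity, ?_⟩
  convert S.add_mem h (S.smul_mem (c := ε / K) (by positivity) h') using 1
  rw [smul_add, smul_smul, div_mul_cancel₀ _ hK.ne']
  module

variable {S} {φ : X →ₗ[ℝ] ℝ}

lemma StrictlyPos.nonneg (hpos : S.StrictlyPos φ) {x : X} (hx : x ∈ S.C) : 0 ≤ φ x := by
  by_cases h : x = 0
  · simp [h]
  · exact (hpos x hx h).le

lemma StrictlyPos.eq_zero (hpos : S.StrictlyPos φ) {x : X} (hx : x ∈ S.C) (h : φ x = 0) :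
    x = 0 := by
  by_contra h0
  exact (hpos x hx h0).ne' h

lemma StrictlyPos.pos_of_interior (hs : S.IsState φ) (hpos : S.StrictlyPos φ) {x : X}
    (hx : x ∈ S.interiorC) : 0 < φ x := by
  obtain ⟨ε, hε, h⟩ := S.mem_interiorC_iff.1 hx
  have h1 := hpos.nonneg h
  have h2 : φ S.u = 1 := hs
  simp only [map_sub, map_smul, h2, smul_eq_mul, mul_one] at h1
  linarith

lemma unit_mem_Sig (hs : S.IsState φ) : S.u ∈ S.Sig φ := ⟨S.unit_mem_interiorC, hs⟩

lemma interiorC_combo {x y : X} (hx : x ∈ S.interiorC) (hy : y ∈ S.interiorC) {s t : ℝ}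
    (hs : 0 ≤ s) (ht : 0 ≤ t) (hst : s + t = 1) : s • x + t • y ∈ S.interiorC := by
  rcases hs.eq_or_lt with rfl | hs
  · have : t = 1 := by linarith
    simpa [this] using hy
  · exact S.interiorC_add (S.interiorC_smul hs hx) (S.smul_mem ht (S.interiorC_subset hy))

lemma Sig_combo {x y : X} (hx : x ∈ S.Sig φ) (hy : y ∈ S.Sig φ) {s t : ℝ}
    (hs : 0 ≤ s) (ht : 0 ≤ t) (hst : s + t = 1) : s • x + t • y ∈ S.Sig φ :=
  ⟨interiorC_combo hx.1 hy.1 hs ht hst, by simp [hx.2, hy.2, hst]⟩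

lemma normalize_mem_Sig (hs : S.IsState φ) (hpos : S.StrictlyPos φ) {x : X}
    (hx : x ∈ S.interiorC) : (φ x)⁻¹ • x ∈ S.Sig φ := by
  have h := hpos.pos_of_interior hs hx
  exact ⟨S.interiorC_smul (inv_pos.2 h) hx, by simp [h.ne']⟩

lemma mem_relBoundary (hs : S.IsState φ) {z : X} (hz : z ∈ S.C) (h1 : φ z = 1)
    (hi : z ∉ S.interiorC) : z ∈ S.relBoundary φ := by
  refine ⟨fun ε hε => ?_, fun h => hi h.1⟩
  obtain ⟨K, hK, h₁, h₂⟩ := S.exists_onorm_bound (S.u - z)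
  obtain ⟨δ, hδ, hδ1, hδε⟩ : ∃ δ > (0 : ℝ), δ ≤ 1 ∧ δ * K < ε := by
    refine ⟨min 1 (ε / (2 * K)), by positivity, min_le_left _ _, ?_⟩
    calc min 1 (ε / (2 * K)) * K ≤ ε / (2 * K) * K := by gcongr; exact min_le_right _ _
      _ = ε / 2 := by field_simp
      _ < ε := by linarith
  have h2 : φ S.u = 1 := hs
  refine ⟨δ • S.u + (1 - δ) • z, ⟨S.interiorC_add (S.interiorC_smul hδ S.unit_mem_interiorC)
    (S.smul_mem (by linarith) hz), by simp [h1, h2]⟩, ?_⟩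
  refine (S.onorm_le (c := δ * K) (by positivity) ?_ ?_).trans_lt hδε
  · convert S.smul_mem hδ.le h₁ using 1
    module
  · convert S.smul_mem hδ.le h₂ using 1
    module

/-- Strict convexity in terms of the cone: two boundary elements whose sum stays on the boundary
are proportional. -/
lemma proportional_of_add_not_interior (hs : S.IsState φ) (hpos : S.StrictlyPos φ)
    (hsc : ∀ x ∈ S.relBoundary φ, ∀ y ∈ S.relBoundary φ, x ≠ y →
      openSegment ℝ x y ⊆ S.Sig φ)
    {p q : X} (hp : p ∈ S.C) (hq : q ∈ S.C) (hp0 : p ≠ 0) (hq0 : q ≠ 0)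
    (h : p + q ∉ S.interiorC) : ∃ c > (0 : ℝ), p = c • q := by
  have hφp := hpos p hp hp0
  have hφq := hpos q hq hq0
  have hpi : p ∉ S.interiorC := fun hi => h (S.interiorC_add hi hq)
  have hqi : q ∉ S.interiorC := fun hi => h (add_comm p q ▸ S.interiorC_add hi hp)
  have hbd : ∀ r ∈ S.C, 0 < φ r → r ∉ S.interiorC → (φ r)⁻¹ • r ∈ S.relBoundary φ := by
    intro r hr hφ hri
    refine mem_relBoundary hs (S.smul_mem (inv_nonneg.2 hφ.le) hr) (by simp [hφ.ne']) fun hi => ?_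
    exact hri (by simpa [smul_smul, hφ.ne'] using S.interiorC_smul hφ hi)
  have heq : (φ p)⁻¹ • p = (φ q)⁻¹ • q := by
    by_contra hne
    have hm : (φ p / (φ p + φ q)) • ((φ p)⁻¹ • p) + (φ q / (φ p + φ q)) • ((φ q)⁻¹ • q)
        ∈ openSegment ℝ ((φ p)⁻¹ • p) ((φ q)⁻¹ • q) :=
      ⟨_, _, by positivity, by positivity, by field_simp, rfl⟩
    have hi := S.interiorC_smul (add_pos hφp hφq)
      (hsc _ (hbd p hp hφp hpi) _ (hbd q hq hφq hqi) hne hm).1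
    apply h
    convert hi using 1
    match_scalars <;> field_simp
  refine ⟨φ p / φ q, by positivity, ?_⟩
  calc p = φ p • ((φ p)⁻¹ • p) := by simp [smul_smul, hφp.ne']
    _ = _ := by rw [heq, smul_smul, div_eq_mul_inv]

lemma M_le {x y : X} {c : ℝ} (hc : 0 < c) (h : c • y - x ∈ S.C) : S.M x y ≤ c :=
  csInf_le ⟨0, fun _ h => h.1.le⟩ ⟨hc, h⟩

lemma M_set_nonempty (x : X) {y : X} (hy : y ∈ S.interiorC) :
    {c : ℝ | 0 < c ∧ c • y - x ∈ S.C}.Nonempty := by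
  obtain ⟨δ, hδ, h⟩ := S.exists_add_smul_mem hy (-x)
  refine ⟨δ⁻¹, inv_pos.2 hδ, ?_⟩
  convert S.smul_mem (inv_nonneg.2 hδ.le) h using 1
  rw [smul_add, smul_smul, inv_mul_cancel₀ hδ.ne']
  module

lemma M_smul_sub_mem (x : X) {y : X} (hy : y ∈ S.interiorC) : S.M x y • y - x ∈ S.C := by
  refine S.mem_of_forall_add_smul_unit fun ε hε => ?_
  obtain ⟨K, hK, h⟩ := S.orderUnit y
  obtain ⟨c, ⟨hc, hcm⟩, hlt⟩ := exists_lt_of_csInf_lt (b := S.M x y + ε / K)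
    (M_set_nonempty x hy) (show S.M x y < _ by have := div_pos hε hK; linarith)
  have hd : (c - S.M x y) * K ≤ ε := by
    rw [← le_div_iff₀ hK]; linarith
  have hnn : 0 ≤ c - S.M x y := sub_nonneg.2 (M_le hc hcm)
  convert S.add_mem hcm (S.add_mem (S.smul_mem hnn h)
    (S.smul_mem (sub_nonneg.2 hd) S.u_mem)) using 1
  module

lemma smul_sub_mem_of_M_le (x : X) {y : X} (hy : y ∈ S.interiorC) {c : ℝ} (h : S.M x y ≤ c) :
    c • y - x ∈ S.C := by
  convert S.add_mem (M_smul_sub_mem x hy) (S.smul_mem (sub_nonneg.2 h) (S.interiorC_subset hy))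
    using 1
  module

lemma one_le_of_smul_sub_mem (hpos : S.StrictlyPos φ) {x y : X} (hx : φ x = 1) (hy : φ y = 1)
    {c : ℝ} (h : c • y - x ∈ S.C) : 1 ≤ c := by
  have := hpos.nonneg h
  simp only [map_sub, map_smul, hx, hy, smul_eq_mul, mul_one] at this
  linarith

lemma one_le_M (hpos : S.StrictlyPos φ) {x y : X} (hx : x ∈ S.Sig φ) (hy : y ∈ S.Sig φ) :
    1 ≤ S.M x y :=
  one_le_of_smul_sub_mem hpos hx.2 hy.2 (M_smul_sub_mem x hy.1)

lemma M_smul_sub_not_interior (hpos : S.StrictlyPos φ) {x y : X} (hx : x ∈ S.Sig φ)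
    (hy : y ∈ S.Sig φ) : S.M x y • y - x ∉ S.interiorC := by
  intro hi
  obtain ⟨δ, hδ, h⟩ := S.exists_add_smul_mem hi (-y)
  have h' : (S.M x y - δ) • y - x ∈ S.C := by
    convert h using 1
    module
  have h1 := one_le_of_smul_sub_mem hpos hx.2 hy.2 h'
  linarith [M_le (by linarith) h']

lemma dH_comm (x y : X) : S.dH x y = S.dH y x := by
  rw [dH, dH, mul_comm]

lemma dH_self (hpos : S.StrictlyPos φ) {x : X} (hx : x ∈ S.Sig φ) : S.dH x x = 0 := by
  have : S.M x x = 1 :=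
    le_antisymm (M_le one_pos (by simpa using S.zero_mem)) (one_le_M hpos hx hx)
  simp [dH, this]

lemma M_le_mul (hpos : S.StrictlyPos φ) {x y z : X} (hx : x ∈ S.Sig φ) (hy : y ∈ S.Sig φ)
    (hz : z ∈ S.Sig φ) : S.M x y ≤ S.M x z * S.M z y := by
  have h1 := one_le_M hpos hx hz
  have h2 := one_le_M hpos hz hy
  refine M_le (by positivity) ?_
  convert S.add_mem (M_smul_sub_mem x hz.1)
    (S.smul_mem (c := S.M x z) (by positivity) (M_smul_sub_mem z hy.1)) using 1
  module

/-- In a strictly convex Hilbert geometry, equality in the triangle inequality forces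
betweenness. -/
lemma mem_segment_of_dH_add (hs : S.IsState φ) (hpos : S.StrictlyPos φ)
    (hsc : ∀ x ∈ S.relBoundary φ, ∀ y ∈ S.relBoundary φ, x ≠ y →
      openSegment ℝ x y ⊆ S.Sig φ)
    {x y z : X} (hx : x ∈ S.Sig φ) (hy : y ∈ S.Sig φ) (hz : z ∈ S.Sig φ)
    (h : S.dH x z + S.dH z y = S.dH x y) : z ∈ segment ℝ x y := by
  have pos : ∀ {v w : X}, v ∈ S.Sig φ → w ∈ S.Sig φ → 0 < S.M v w :=
    fun hv hw => one_pos.trans_le (one_le_M hpos hv hw)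
  have hxz := pos hx hz
  have hzx := pos hz hx
  have hzy := pos hz hy
  have hyz := pos hy hz
  have hxy := pos hx hy
  have hyx := pos hy hx
  have hM : S.M x y = S.M x z * S.M z y := by
    have h1 := M_le_mul hpos hx hy hz
    have h2 := M_le_mul hpos hy hx hz
    rw [dH, dH, dH, ← Real.log_mul (by positivity) (by positivity)] at h
    have h3 := Real.log_injOn_pos (Set.mem_Ioi.2 (by positivity)) (Set.mem_Ioi.2 (by positivity)) h
    refine le_antisymm h1 ?_
    by_contra! hlt
    have := mul_lt_mul'' hlt (lt_of_le_of_ne h2 (fun h4 => ?_)) hxy.le hyx.le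
    · nlinarith
    · rw [h4] at h3
      have : S.M x z * S.M z y = S.M x y := by
        have h5 : 0 < S.M y z * S.M z x := by positivity
        apply mul_right_cancel₀ h5.ne'
        linarith
      exact hlt.ne' this
  set α := S.M x z
  set β := S.M z y
  have hp : α • (β • y - z) ∈ S.C := S.smul_mem hxz.le (M_smul_sub_mem z hy.1)
  have hq : α • z - x ∈ S.C := M_smul_sub_mem x hz.1
  have hsum : α • (β • y - z) + (α • z - x) ∉ S.interiorC := by
    convert M_smul_sub_not_interior hpos hx hy using 2
    rw [hM]
    module
  by_cases hp0 : α • (β • y - z) = 0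
  · have h1 : β • y - z = 0 := (smul_eq_zero.1 hp0).resolve_left hxz.ne'
    have h2 : β = 1 := by
      have := congrArg φ h1
      simp only [map_sub, map_smul, hy.2, hz.2, smul_eq_mul, mul_one, map_zero] at this
      linarith
    have : z = y := by
      rw [h2, one_smul, sub_eq_zero] at h1
      exact h1.symm
    rw [this]
    exact right_mem_segment ℝ x y
  by_cases hq0 : α • z - x = 0
  · have h2 : α = 1 := by
      have := congrArg φ hq0
      simp only [map_sub, map_smul, hx.2, hz.2, smul_eq_mul, mul_one, map_zero] at this
      linarith
    have : z = x := by
      rw [h2, one_smul, sub_eq_zero] at hq0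
      exact hq0
    rw [this]
    exact left_mem_segment ℝ x y
  obtain ⟨c, hc, heq⟩ := proportional_of_add_not_interior hs hpos hsc hp hq hp0 hq0 hsum
  have hφ : α * (β - 1) = c * (α - 1) := by
    have := congrArg φ heq
    simpa [hx.2, hy.2, hz.2] using this
  have hD : 0 < α * (1 + c) := by positivity
  refine ⟨c / (α * (1 + c)), α * β / (α * (1 + c)), by positivity, by positivity, ?_, ?_⟩
  · rw [← add_div, div_eq_one_iff_eq hD.ne']
    linarith
  · have h3 : (α * (1 + c)) • z = c • x + (α * β) • y := by
      linear_combination (norm := module) (-1 : ℝ) • heq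
    calc _ = (α * (1 + c))⁻¹ • (c • x + (α * β) • y) := by
          match_scalars <;> field_simp
      _ = z := by rw [← h3, smul_smul, inv_mul_cancel₀ hD.ne', one_smul]

end OrderUnitSpace

namespace OrderUnitSpace

variable {X : Type*} [AddCommGroup X] [Module ℝ X] {S : OrderUnitSpace X} {φ : X →ₗ[ℝ] ℝ}

/-- The point of the open segment between `a` and `b` with homogeneous coordinates `(1 : p)`. -/
noncomputable def pt (a b : X) (p : ℝ) : X := (1 + p)⁻¹ • (a + p • b)

lemma pt_swap (a b : X) {p : ℝ} (hp : 0 < p) : pt a b p = pt b a p⁻¹ := by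
  unfold pt
  match_scalars
  all_goals field_simp
  all_goals ring

variable (S φ) in
/-- `a` and `b` are the two endpoints of a line through the cross section `Σ_φ`. -/
structure IsEndPair (a b : X) : Prop where
  left : φ a = 1
  right : φ b = 1
  mem_iff : ∀ r s : ℝ, r • a + s • b ∈ S.C ↔ 0 ≤ r ∧ 0 ≤ s
  pt_mem : ∀ p > 0, pt a b p ∈ S.Sig φ

/-- A line through two interior points leaves the cone beyond the second one. -/
lemma exists_exit (hpos : S.StrictlyPos φ) {x y : X} (hx : x ∈ S.Sig φ) (hy : y ∈ S.Sig φ)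
    (hxy : x ≠ y) :
    ∃ β > (1 : ℝ), x + β • (y - x) ∈ S.C ∧ ∀ t : ℝ, x + t • (y - x) ∈ S.C → t ≤ β := by
  set A : Set ℝ := {t | x + t • (y - x) ∈ S.C} with hA
  have h1 : (1 : ℝ) ∈ A := by simpa [hA] using S.interiorC_subset hy.1
  have hb : BddAbove A := by
    by_contra hnb
    rw [not_bddAbove_iff] at hnb
    have hv : y - x ∈ S.C := by
      have := S.archimedean (-(y - x)) x (S.interiorC_subset hx.1) (fun n hn => by
        have hn' : (0 : ℝ) < n := by exact_mod_cast hn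
        obtain ⟨t, ht, hnt⟩ := hnb n
        have ht0 : 0 < t := hn'.trans hnt
        convert S.convex (S.interiorC_subset hx.1) ht
          (sub_nonneg.2 ((div_le_one ht0).2 hnt.le)) (div_nonneg hn'.le ht0.le) (by ring) using 1
        match_scalars <;> field_simp
        ring)
      simpa using this
    have := hpos.eq_zero hv (by simp [hx.2, hy.2])
    exact hxy (sub_eq_zero.1 this).symm
  refine ⟨sSup A, ?_, ?_, fun t ht => le_csSup hb ht⟩
  · obtain ⟨δ, hδ, h⟩ := S.exists_add_smul_mem hy.1 (y - x)
    have : 1 + δ ∈ A := by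
      rw [hA, Set.mem_ofPred_eq]
      convert h using 1
      module
    linarith [le_csSup hb this]
  · refine S.mem_of_forall_add_smul_unit fun ε hε => ?_
    obtain ⟨K, hK, h⟩ := S.exists_add_mem (y - x)
    obtain ⟨t, ht, hlt⟩ := exists_lt_of_lt_csSup (b := sSup A - ε / K) ⟨1, h1⟩
      (by have := div_pos hε hK; linarith)
    have hd : (sSup A - t) * K ≤ ε := by
      rw [← le_div_iff₀ hK]; linarith
    convert S.add_mem ht (S.add_mem (S.smul_mem (sub_nonneg.2 (le_csSup hb ht)) h)
      (S.smul_mem (sub_nonneg.2 hd) S.u_mem)) using 1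
    module

lemma exists_isEndPair (hpos : S.StrictlyPos φ) {x y : X}
    (hx : x ∈ S.Sig φ) (hy : y ∈ S.Sig φ) (hxy : x ≠ y) :
    ∃ a b : X, ∃ p > (0 : ℝ), ∃ q > (0 : ℝ), S.IsEndPair φ a b ∧ x = pt a b p ∧ y = pt a b q := by
  obtain ⟨β, hβ, hb, hβm⟩ := exists_exit hpos hx hy hxy
  obtain ⟨α, hα, ha, hαm⟩ := exists_exit hpos hy hx hxy.symm
  set a := y + α • (x - y) with ha'
  set b := x + β • (y - x) with hb'
  have hφa : φ a = 1 := by simp [ha', hx.2, hy.2]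
  have hφb : φ b = 1 := by simp [hb', hx.2, hy.2]
  have hα0 : 0 < α := by linarith
  have hL : 0 < α + β - 1 := by linarith
  have hα1 : 0 < α - 1 := by linarith
  have hβ1 : 0 < β - 1 := by linarith
  have hxp : x = pt a b ((α - 1) / β) := by
    have : 1 + (α - 1) / β ≠ 0 := by positivity
    have : β + (α - 1) ≠ 0 := by linarith
    rw [ha', hb']
    unfold pt
    match_scalars <;> field_simp <;> ring
  have hyp : y = pt a b (α / (β - 1)) := by
    have : 1 + α / (β - 1) ≠ 0 := by positivity
    have : β - 1 + α ≠ 0 := by linarith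
    rw [ha', hb']
    unfold pt
    match_scalars <;> field_simp <;> ring
  have hmem : ∀ r s : ℝ, 0 ≤ r → 0 ≤ s → r • a + s • b ∈ S.C := fun r s hr hs =>
    S.add_mem (S.smul_mem hr ha) (S.smul_mem hs hb)
  refine ⟨a, b, (α - 1) / β, by positivity, α / (β - 1), by positivity, ⟨hφa, hφb, ?_, ?_⟩,
    hxp, hyp⟩
  · refine fun r s => ⟨fun h => ?_, fun h => hmem r s h.1 h.2⟩
    have h0 := hpos.nonneg h
    simp only [map_add, map_smul, hφa, hφb, smul_eq_mul, mul_one] at h0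
    rcases h0.eq_or_lt with h0 | h0
    · have hs : s = -r := by linarith
      have h2 := hpos.eq_zero h (by simp [hφa, hφb, ← h0])
      have h3 : (-(r * (α + β - 1))) • (y - x) = 0 := by
        rw [← h2, ha', hb', hs]
        module
      rcases smul_eq_zero.1 h3 with h3 | h3
      · have : r = 0 := (mul_eq_zero.1 (neg_eq_zero.1 h3)).resolve_right hL.ne'
        simp [hs, this]
      · exact absurd (sub_eq_zero.1 h3).symm hxy
    · have h4 := S.smul_mem (inv_nonneg.2 h0.le) h
      have h5 := hβm ((r * (1 - α) + s * β) / (r + s)) (by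
        convert h4 using 1
        rw [ha', hb']
        match_scalars <;> field_simp <;> ring)
      have h6 := hαm ((r * α + s * (1 - β)) / (r + s)) (by
        convert h4 using 1
        rw [ha', hb']
        match_scalars <;> field_simp <;> ring)
      rw [div_le_iff₀ h0] at h5 h6
      constructor
      · by_contra! hr
        nlinarith [mul_pos_of_neg_of_neg hr (by linarith : -(α + β - 1) < 0)]
      · by_contra! hs
        nlinarith [mul_pos_of_neg_of_neg hs (by linarith : -(α + β - 1) < 0)]
  · intro p hp
    have hp1 : 1 + p ≠ 0 := by positivity
    refine ⟨?_, by simp [pt, hφa, hφb, ← mul_one_add, hp1]⟩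
    obtain ⟨q, hq, hxq⟩ : ∃ q > 0, x = pt a b q := ⟨_, by positivity, hxp⟩
    obtain ⟨δ, hδ, h1, h2⟩ : ∃ δ > 0, δ ≤ (1 + p)⁻¹ ∧ δ * q ≤ (1 + p)⁻¹ * p := by
      refine ⟨min (1 + p)⁻¹ ((1 + p)⁻¹ * p / q), by positivity, min_le_left _ _, ?_⟩
      rw [← le_div_iff₀ hq]
      exact min_le_right _ _
    have hi := S.interiorC_smul (mul_pos hδ (by positivity : 0 < 1 + q)) hx.1
    convert S.interiorC_add hi (hmem _ _ (sub_nonneg.2 h1) (sub_nonneg.2 h2)) using 1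
    rw [hxq]
    unfold pt
    match_scalars <;> field_simp <;> ring

namespace IsEndPair

variable {a b : X}

lemma coeff_pos (h : S.IsEndPair φ a b) {r s : ℝ} (hrs : r • a + s • b ∈ S.interiorC) :
    0 < r ∧ 0 < s := by
  obtain ⟨δ, hδ, hm⟩ := S.exists_add_smul_mem hrs (-(a + b))
  have := (h.mem_iff (r - δ) (s - δ)).1 (by convert hm using 1; module)
  constructor <;> linarith

lemma exists_pt (h : S.IsEndPair φ a b) {r s : ℝ} (hrs : r • a + s • b ∈ S.Sig φ) :
    ∃ p > 0, r • a + s • b = pt a b p := by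
  obtain ⟨hr, hs⟩ := h.coeff_pos hrs.1
  have h1 : r + s = 1 := by simpa [h.left, h.right] using hrs.2
  refine ⟨s / r, by positivity, ?_⟩
  have hs' : s = 1 - r := by linarith
  unfold pt
  match_scalars <;> field_simp
  all_goals simp [h1]

lemma smul_pt_sub_mem_iff (h : S.IsEndPair φ a b) {p q : ℝ} (hp : 0 < p) (hq : 0 < q) (c : ℝ) :
    c • pt a b q - pt a b p ∈ S.C ↔
      (1 + q) / (1 + p) ≤ c ∧ p / q * ((1 + q) / (1 + p)) ≤ c := by
  have : c • pt a b q - pt a b p =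
      (c / (1 + q) - 1 / (1 + p)) • a + (c * q / (1 + q) - p / (1 + p)) • b := by
    unfold pt
    match_scalars <;> field_simp
  rw [this, h.mem_iff, sub_nonneg, sub_nonneg, div_le_div_iff₀ (by positivity) (by positivity),
    div_le_div_iff₀ (by positivity) (by positivity), div_le_iff₀ (by positivity), div_mul_div_comm,
    div_le_iff₀ (by positivity), one_mul]
  ring_nf

lemma M_pt (h : S.IsEndPair φ a b) {p q : ℝ} (hp : 0 < p) (hq : 0 < q) :
    S.M (pt a b p) (pt a b q) = max ((1 + q) / (1 + p)) (p / q * ((1 + q) / (1 + p))) := by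
  refine IsLeast.csInf_eq ⟨⟨by positivity, ?_⟩, fun c hc => ?_⟩
  · rw [h.smul_pt_sub_mem_iff hp hq]
    exact ⟨le_max_left _ _, le_max_right _ _⟩
  · rw [Set.mem_ofPred_eq, h.smul_pt_sub_mem_iff hp hq] at hc
    exact max_le hc.2.1 hc.2.2

lemma dH_pt_of_le (h : S.IsEndPair φ a b) {p q : ℝ} (hp : 0 < p) (hpq : p ≤ q) :
    S.dH (pt a b p) (pt a b q) = Real.log q - Real.log p := by
  have hq := hp.trans_le hpq
  rw [dH, h.M_pt hp hq, h.M_pt hq hp, ← Real.log_div hq.ne' hp.ne', max_eq_left, max_eq_right]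
  · congr 1
    field_simp
  · exact le_mul_of_one_le_left (by positivity) ((one_le_div hp).2 hpq)
  · exact mul_le_of_le_one_left (by positivity) ((div_le_one hq).2 hpq)

lemma dH_pt (h : S.IsEndPair φ a b) {p q : ℝ} (hp : 0 < p) (hq : 0 < q) :
    S.dH (pt a b p) (pt a b q) = |Real.log p - Real.log q| := by
  rcases le_total p q with hpq | hpq
  · rw [h.dH_pt_of_le hp hpq, abs_sub_comm, abs_of_nonneg]
    exact sub_nonneg.2 (Real.log_le_log hp hpq)
  · rw [dH_comm, h.dH_pt_of_le hq hpq, abs_of_nonneg]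
    exact sub_nonneg.2 (Real.log_le_log hq hpq)

lemma combo_pt (a b : X) {p q s t : ℝ} (hp : 0 < p) (hq : 0 < q) (hs : 0 ≤ s) (ht : 0 ≤ t)
    (hst : s + t = 1) :
    s • pt a b p + t • pt a b q =
      pt a b ((s * p * (1 + q) + t * q * (1 + p)) / (s * (1 + q) + t * (1 + p))) := by
  have h1 : 0 < s * (1 + q) + t * (1 + p) := by
    have : s * (1 + q) + t * (1 + p) = 1 + s * q + t * p := by linear_combination hst
    rw [this]
    positivity
  have h2 : 1 + (s * p * (1 + q) + t * q * (1 + p)) / (s * (1 + q) + t * (1 + p)) =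
      (1 + p) * (1 + q) / (s * (1 + q) + t * (1 + p)) := by
    field_simp
    linear_combination (1 + p) * (1 + q) * hst
  unfold pt
  rw [h2]
  generalize hD : s * (1 + q) + t * (1 + p) = D at h1 ⊢
  match_scalars <;> field_simp
  linear_combination hD

lemma swap_of_pt (h : S.IsEndPair φ a b) : S.IsEndPair φ b a where
  left := h.right
  right := h.left
  mem_iff r s := by rw [add_comm, h.mem_iff, and_comm]
  pt_mem p hp := by
    rw [pt_swap b a hp]
    exact h.pt_mem _ (inv_pos.2 hp)

end IsEndPair

lemma dH_ne_zero (hpos : S.StrictlyPos φ) {x y : X} (hx : x ∈ S.Sig φ)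
    (hy : y ∈ S.Sig φ) (hxy : x ≠ y) : S.dH x y ≠ 0 := by
  obtain ⟨a, b, p, hp, q, hq, h, rfl, rfl⟩ := exists_isEndPair hpos hx hy hxy
  rw [h.dH_pt hp hq]
  intro h0
  have := Real.log_injOn_pos hp hq (sub_eq_zero.1 (abs_eq_zero.1 h0))
  exact hxy (by rw [this])

lemma dH_add_of_mem_segment (hpos : S.StrictlyPos φ) {x y z : X}
    (hx : x ∈ S.Sig φ) (hy : y ∈ S.Sig φ) (hz : z ∈ segment ℝ x y) :
    S.dH x z + S.dH z y = S.dH x y := by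
  obtain ⟨s, t, hs, ht, hst, rfl⟩ := hz
  by_cases hxy : x = y
  · subst hxy
    rw [← add_smul, hst, one_smul, dH_self hpos hx, add_zero]
  obtain ⟨a, b, p, hp, q, hq, h, rfl, rfl⟩ := exists_isEndPair hpos hx hy hxy
  rw [IsEndPair.combo_pt a b hp hq hs ht hst]
  have h1 : 0 < s * (1 + q) + t * (1 + p) := by
    have : s * (1 + q) + t * (1 + p) = 1 + s * q + t * p := by linear_combination hst
    rw [this]
    positivity
  rcases le_total p q with hpq | hpq
  · have e1 : p ≤ (s * p * (1 + q) + t * q * (1 + p)) / (s * (1 + q) + t * (1 + p)) := by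
      rw [le_div_iff₀ h1]
      nlinarith [mul_nonneg ht (sub_nonneg.2 hpq),
        mul_nonneg (mul_nonneg ht (sub_nonneg.2 hpq)) hp.le]
    have e2 : (s * p * (1 + q) + t * q * (1 + p)) / (s * (1 + q) + t * (1 + p)) ≤ q := by
      rw [div_le_iff₀ h1]
      nlinarith [mul_nonneg hs (sub_nonneg.2 hpq),
        mul_nonneg (mul_nonneg hs (sub_nonneg.2 hpq)) hq.le]
    rw [h.dH_pt_of_le hp e1, h.dH_pt_of_le (hp.trans_le e1) e2, h.dH_pt_of_le hp hpq]
    ring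
  · have e1 : q ≤ (s * p * (1 + q) + t * q * (1 + p)) / (s * (1 + q) + t * (1 + p)) := by
      rw [le_div_iff₀ h1]
      nlinarith [mul_nonneg hs (sub_nonneg.2 hpq),
        mul_nonneg (mul_nonneg hs (sub_nonneg.2 hpq)) hq.le]
    have e2 : (s * p * (1 + q) + t * q * (1 + p)) / (s * (1 + q) + t * (1 + p)) ≤ p := by
      rw [div_le_iff₀ h1]
      nlinarith [mul_nonneg ht (sub_nonneg.2 hpq),
        mul_nonneg (mul_nonneg ht (sub_nonneg.2 hpq)) hp.le]
    rw [dH_comm (pt a b p), dH_comm _ (pt a b q), dH_comm (pt a b p),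
      h.dH_pt_of_le (hq.trans_le e1) e2, h.dH_pt_of_le hq e1, h.dH_pt_of_le hq hpq]
    ring

end OrderUnitSpace

/-- A distance preserving self-map of the multiplicative group of positive reals, with the metric
`|log p - log q|`, is a multiplication, possibly preceded by inversion. -/
lemma eq_mul_or_eq_mul_inv_of_log_isometry {h : ℝ → ℝ} (hpos : ∀ p > 0, 0 < h p)
    (hiso : ∀ p > 0, ∀ q > 0,
      |Real.log (h p) - Real.log (h q)| = |Real.log p - Real.log q|) :
    ∃ κ > 0, (∀ p > 0, h p = κ * p) ∨ ∀ p > 0, h p = κ * p⁻¹ := by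
  have hsq : ∀ p > 0, ∀ q > 0,
      (Real.log (h p) - Real.log (h q)) ^ 2 = (Real.log p - Real.log q) ^ 2 :=
    fun p hp q hq => sq_eq_sq_iff_abs_eq_abs _ _ |>.2 (hiso p hp q hq)
  have he := Real.exp_pos 1
  have h1 := hpos 1 one_pos
  refine ⟨h 1, h1, ?_⟩
  have hlin : ∀ p > 0, (Real.log (h p) - Real.log (h 1)) *
      (Real.log (h (Real.exp 1)) - Real.log (h 1)) = Real.log p := by
    intro p hp
    have h1 := hsq p hp 1 one_pos
    have h2 := hsq p hp _ he
    have h3 := hsq _ he 1 one_pos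
    rw [Real.log_exp, Real.log_one] at *
    linear_combination (h1 + h3 - h2) / 2
  have h3 := hsq _ he 1 one_pos
  rw [Real.log_exp, Real.log_one, sub_zero] at h3
  rcases eq_or_eq_neg_of_sq_eq_sq _ _ h3 with h4 | h4
  · left
    intro p hp
    refine Real.log_injOn_pos (hpos p hp) (mul_pos h1 hp) ?_
    rw [Real.log_mul h1.ne' hp.ne', ← hlin p hp, h4]
    ring
  · right
    intro p hp
    refine Real.log_injOn_pos (hpos p hp) (mul_pos h1 (inv_pos.2 hp)) ?_
    rw [Real.log_mul h1.ne' (inv_pos.2 hp).ne', Real.log_inv, ← hlin p hp, h4]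
    ring

section Isometry

variable {X₁ : Type*} [AddCommGroup X₁] [Module ℝ X₁] {X₂ : Type*} [AddCommGroup X₂] [Module ℝ X₂]

/-- The standing assumptions: `f` is a distance preserving map between strictly convex Hilbert
geometries. -/
structure IsStrictIsometry (S₁ : OrderUnitSpace X₁) (S₂ : OrderUnitSpace X₂)
    (φ₁ : X₁ →ₗ[ℝ] ℝ) (φ₂ : X₂ →ₗ[ℝ] ℝ) (f : X₁ → X₂) : Prop where
  state₁ : S₁.IsState φ₁
  pos₁ : S₁.StrictlyPos φ₁
  state₂ : S₂.IsState φ₂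
  pos₂ : S₂.StrictlyPos φ₂
  strict₁ : ∀ x ∈ S₁.relBoundary φ₁, ∀ y ∈ S₁.relBoundary φ₁, x ≠ y →
    openSegment ℝ x y ⊆ S₁.Sig φ₁
  strict₂ : ∀ x ∈ S₂.relBoundary φ₂, ∀ y ∈ S₂.relBoundary φ₂, x ≠ y →
    openSegment ℝ x y ⊆ S₂.Sig φ₂
  maps : Set.MapsTo f (S₁.Sig φ₁) (S₂.Sig φ₂)
  iso : ∀ x ∈ S₁.Sig φ₁, ∀ y ∈ S₁.Sig φ₁, S₂.dH (f x) (f y) = S₁.dH x y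

/-- `f` restricted to the segment from `x` to `y` is the projective map of cross-ratio parameter
`ρ`. -/
def ProjOnSegment (f : X₁ → X₂) (x y : X₁) (ρ : ℝ) : Prop :=
  0 < ρ ∧ ∀ s t : ℝ, 0 ≤ s → 0 ≤ t → s + t = 1 →
    f (s • x + t • y) = (s + t * ρ)⁻¹ • (s • f x + (t * ρ) • f y)

namespace ProjOnSegment

variable {f : X₁ → X₂} {x y : X₁} {ρ ρ' : ℝ}

lemma denom_pos (hρ : 0 < ρ) {s t : ℝ} (hs : 0 ≤ s) (ht : 0 ≤ t) (hst : s + t = 1) :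
    0 < s + t * ρ := by
  rcases hs.eq_or_lt with rfl | hs
  · have : t = 1 := by linarith
    simpa [this] using hρ
  · positivity

lemma unique (h : ProjOnSegment f x y ρ) (h' : ProjOnSegment f x y ρ') (hxy : f x ≠ f y) :
    ρ = ρ' := by
  have e := (h.2 (1 / 2) (1 / 2) (by norm_num) (by norm_num) (by norm_num)).symm.trans
    (h'.2 (1 / 2) (1 / 2) (by norm_num) (by norm_num) (by norm_num))
  have hρ := h.1
  have hρ' := h'.1
  have e2 : ((1 + ρ)⁻¹ - (1 + ρ')⁻¹) • (f x - f y) = 0 := by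
    rw [← sub_eq_zero] at e
    rw [← e]
    match_scalars <;> field_simp
    all_goals ring
  have e3 := (smul_eq_zero.1 e2).resolve_right (sub_ne_zero.2 hxy)
  have := inv_injective (sub_eq_zero.1 e3)
  linarith

lemma symm (h : ProjOnSegment f x y ρ) : ProjOnSegment f y x ρ⁻¹ := by
  have hρ := h.1
  refine ⟨inv_pos.2 hρ, fun s t hs ht hst => ?_⟩
  have h1 := denom_pos hρ ht hs (by linarith)
  have h2 : s + t * ρ⁻¹ = (t + s * ρ) * ρ⁻¹ := by field_simp; ring
  rw [add_comm (s • y), h.2 t s ht hs (by linarith), h2]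
  match_scalars <;> field_simp

lemma restrict (h : ProjOnSegment f x y ρ) {s t : ℝ} (hs : 0 ≤ s) (ht : 0 ≤ t)
    (hst : s + t = 1) : ProjOnSegment f x (s • x + t • y) (s + t * ρ) := by
  have hd := denom_pos h.1 hs ht hst
  refine ⟨hd, fun s' t' hs' ht' hst' => ?_⟩
  have e : s' • x + t' • (s • x + t • y) = (s' + t' * s) • x + (t' * t) • y := by module
  have h2 : s' + t' * s + t' * t = 1 := by linear_combination hst' + t' * hst
  have h3 := denom_pos h.1 (by positivity) (by positivity) h2
  rw [e, h.2 _ _ (by positivity) (by positivity) h2, h.2 s t hs ht hst]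
  have h4 : s' + t' * (s + t * ρ) = s' + t' * s + t' * t * ρ := by ring
  rw [h4]
  match_scalars <;> field_simp

end ProjOnSegment

namespace IsStrictIsometry

variable {S₁ : OrderUnitSpace X₁} {S₂ : OrderUnitSpace X₂} {φ₁ : X₁ →ₗ[ℝ] ℝ} {φ₂ : X₂ →ₗ[ℝ] ℝ}
  {f : X₁ → X₂} (H : IsStrictIsometry S₁ S₂ φ₁ φ₂ f)

include H

lemma map_ne {x y : X₁} (hx : x ∈ S₁.Sig φ₁) (hy : y ∈ S₁.Sig φ₁) (hxy : x ≠ y) : f x ≠ f y := by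
  intro h
  apply dH_ne_zero H.pos₁ hx hy hxy
  rw [← H.iso x hx y hy, h, dH_self H.pos₂ (H.maps hy)]

lemma map_mem_segment_iff {x y z : X₁} (hx : x ∈ S₁.Sig φ₁) (hy : y ∈ S₁.Sig φ₁)
    (hz : z ∈ S₁.Sig φ₁) : f z ∈ segment ℝ (f x) (f y) ↔ z ∈ segment ℝ x y := by
  constructor <;> intro h
  · have := dH_add_of_mem_segment H.pos₂ (H.maps hx) (H.maps hy) h
    rw [H.iso x hx z hz, H.iso z hz y hy, H.iso x hx y hy] at this
    exact mem_segment_of_dH_add H.state₁ H.pos₁ H.strict₁ hx hy hz this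
  · have := dH_add_of_mem_segment H.pos₁ hx hy h
    rw [← H.iso x hx z hz, ← H.iso z hz y hy, ← H.iso x hx y hy] at this
    exact mem_segment_of_dH_add H.state₂ H.pos₂ H.strict₂ (H.maps hx) (H.maps hy) (H.maps hz) this

lemma map_pt_mem_segment {a b : X₁} (h : S₁.IsEndPair φ₁ a b) {p q r : ℝ} (hp : 0 < p)
    (hpq : p ≤ q) (hqr : q ≤ r) : f (pt a b q) ∈ segment ℝ (f (pt a b p)) (f (pt a b r)) := by
  have hq := hp.trans_le hpq
  have mp := h.pt_mem p hp
  have mq := h.pt_mem q hq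
  have mr := h.pt_mem r (hq.trans_le hqr)
  refine mem_segment_of_dH_add H.state₂ H.pos₂ H.strict₂ (H.maps mp) (H.maps mr) (H.maps mq) ?_
  rw [H.iso _ mp _ mq, H.iso _ mq _ mr, H.iso _ mp _ mr, h.dH_pt_of_le hp hpq,
    h.dH_pt_of_le hq hqr, h.dH_pt_of_le hp (hpq.trans hqr)]
  ring

/-- The isometry maps lines projectively onto lines. -/
lemma exists_map_pt {a b : X₁} (h : S₁.IsEndPair φ₁ a b) :
    ∃ a' b' : X₂, ∃ κ > (0 : ℝ), S₂.IsEndPair φ₂ a' b' ∧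
      ∀ p > 0, f (pt a b p) = pt a' b' (κ * p) := by
  have m1 := h.pt_mem 1 one_pos
  have m2 := h.pt_mem 2 two_pos
  have hne : f (pt a b 1) ≠ f (pt a b 2) := by
    intro he
    have h0 := H.iso _ m1 _ m2
    rw [he, dH_self H.pos₂ (H.maps m2), h.dH_pt_of_le one_pos one_le_two, Real.log_one,
      sub_zero] at h0
    exact (Real.log_pos one_lt_two).ne h0
  obtain ⟨a', b', r₁, hr₁, r₂, hr₂, h', hx, hy⟩ :=
    exists_isEndPair H.pos₂ (H.maps m1) (H.maps m2) hne
  have hline : ∀ p > 0, ∃ q > 0, f (pt a b p) = pt a' b' q := by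
    intro p hp
    obtain ⟨c, d, hcd⟩ : ∃ c d : ℝ, f (pt a b p) = c • f (pt a b 1) + d • f (pt a b 2) := by
      rcases le_total p 1 with hp1 | hp1
      · obtain ⟨s, t, -, -, hst, he⟩ := H.map_pt_mem_segment h hp hp1 one_le_two
        have hs : s ≠ 0 := by
          rintro rfl
          rw [zero_add] at hst
          exact hne (by rw [← he, hst]; simp)
        refine ⟨s⁻¹, -(s⁻¹ * t), ?_⟩
        rw [← he]
        match_scalars <;> field_simp
        ring
      rcases le_total p 2 with hp2 | hp2
      · obtain ⟨s, t, -, -, hst, he⟩ := H.map_pt_mem_segment h one_pos hp1 hp2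
        exact ⟨s, t, he.symm⟩
      · obtain ⟨s, t, -, -, hst, he⟩ := H.map_pt_mem_segment h one_pos one_le_two hp2
        have ht : t ≠ 0 := by
          rintro rfl
          rw [add_zero] at hst
          exact hne (by rw [← he, hst]; simp)
        refine ⟨-(t⁻¹ * s), t⁻¹, ?_⟩
        rw [← he]
        match_scalars <;> field_simp
        ring
    have hm := H.maps (h.pt_mem p hp)
    have he : f (pt a b p) = (c * (1 + r₁)⁻¹ + d * (1 + r₂)⁻¹) • a' +
        (c * (1 + r₁)⁻¹ * r₁ + d * (1 + r₂)⁻¹ * r₂) • b' := by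
      rw [hcd, hx, hy]
      unfold pt
      module
    rw [he] at hm ⊢
    exact h'.exists_pt hm
  choose! g hg0 hg using hline
  obtain ⟨κ, hκ, hmul | hinv⟩ := eq_mul_or_eq_mul_inv_of_log_isometry hg0 (fun p hp q hq => by
    rw [← h'.dH_pt (hg0 p hp) (hg0 q hq), ← hg p hp, ← hg q hq,
      H.iso _ (h.pt_mem p hp) _ (h.pt_mem q hq), h.dH_pt hp hq])
  · exact ⟨a', b', κ, hκ, h', fun p hp => by rw [hg p hp, hmul p hp]⟩
  · refine ⟨b', a', κ⁻¹, inv_pos.2 hκ, h'.swap_of_pt, fun p hp => ?_⟩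
    rw [hg p hp, hinv p hp, pt_swap a' b' (by positivity), mul_inv, inv_inv]

lemma exists_projOnSegment {x y : X₁} (hx : x ∈ S₁.Sig φ₁) (hy : y ∈ S₁.Sig φ₁) :
    ∃ ρ, ProjOnSegment f x y ρ := by
  by_cases hxy : x = y
  · subst hxy
    refine ⟨1, one_pos, fun s t _ _ hst => ?_⟩
    rw [mul_one, ← add_smul, ← add_smul, hst]
    simp
  obtain ⟨a, b, p, hp, q, hq, h, rfl, rfl⟩ := exists_isEndPair H.pos₁ hx hy hxy
  obtain ⟨a', b', κ, hκ, -, hf⟩ := H.exists_map_pt h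
  refine ⟨(1 + κ * q) / (1 + q) / ((1 + κ * p) / (1 + p)), by positivity,
    fun s t hs ht hst => ?_⟩
  have h1 : 0 < s * (1 + q) + t * (1 + p) := by
    have : s * (1 + q) + t * (1 + p) = 1 + s * q + t * p := by linear_combination hst
    rw [this]
    positivity
  have h2 : 0 < s * p * (1 + q) + t * q * (1 + p) := by
    rcases hs.eq_or_lt with rfl | hs
    · have : t = 1 := by linarith
      subst this
      positivity
    · positivity
  rw [IsEndPair.combo_pt a b hp hq hs ht hst, hf _ (by positivity), hf p hp, hf q hq]
  generalize hD : s * (1 + q) + t * (1 + p) = D at h1 ⊢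
  generalize hE : s * p * (1 + q) + t * q * (1 + p) = E at h2 ⊢
  have h3 : s + t * ((1 + κ * q) / (1 + q) / ((1 + κ * p) / (1 + p))) =
      (D + κ * E) / ((1 + q) * (1 + κ * p)) := by
    rw [← hD, ← hE]
    field_simp
    ring
  rw [h3]
  unfold pt
  match_scalars <;> field_simp
  · linear_combination -hD
  · linear_combination -hE

end IsStrictIsometry

end Isometry

namespace OrderUnitSpace

/-- An additive and positively homogeneous map on the interior of the cone extends linearly. -/
lemma exists_linearMap_extension {X Y : Type*} [AddCommGroup X] [Module ℝ X] [AddCommGroup Y]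
    [Module ℝ Y] (S : OrderUnitSpace X) (G : X → Y)
    (hadd : ∀ x ∈ S.interiorC, ∀ y ∈ S.interiorC, G (x + y) = G x + G y)
    (hsmul : ∀ c > (0 : ℝ), ∀ x ∈ S.interiorC, G (c • x) = c • G x) :
    ∃ T : X →ₗ[ℝ] Y, ∀ x ∈ S.interiorC, T x = G x := by
  have hu := S.unit_mem_interiorC
  have hex : ∀ v : X, ∃ c > (0 : ℝ), v + c • S.u ∈ S.interiorC := by
    intro v
    obtain ⟨c, hc, h⟩ := S.exists_add_mem v
    refine ⟨c + 1, by positivity, ?_⟩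
    convert S.interiorC_add hu h using 1
    module
  choose c hc hcv using hex
  have key : ∀ v : X, ∀ d > (0 : ℝ), v + d • S.u ∈ S.interiorC →
      G (v + c v • S.u) - G (c v • S.u) = G (v + d • S.u) - G (d • S.u) := by
    intro v d hd hv
    have h1 := hadd _ (hcv v) _ (S.interiorC_smul hd hu)
    have h2 := hadd _ hv _ (S.interiorC_smul (hc v) hu)
    rw [show v + c v • S.u + d • S.u = v + d • S.u + c v • S.u by abel, h2] at h1
    rw [sub_eq_sub_iff_add_eq_add]
    exact h1.symm
  have map_add : ∀ v w : X, G (v + w + c (v + w) • S.u) - G (c (v + w) • S.u) =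
      G (v + c v • S.u) - G (c v • S.u) + (G (w + c w • S.u) - G (c w • S.u)) := by
    intro v w
    have e : v + w + (c v + c w) • S.u = (v + c v • S.u) + (w + c w • S.u) := by module
    rw [key (v + w) (c v + c w) (add_pos (hc v) (hc w))
      (e ▸ S.interiorC_add (hcv v) (S.interiorC_subset (hcv w))), e, add_smul,
      hadd _ (hcv v) _ (hcv w), hadd _ (S.interiorC_smul (hc v) hu) _ (S.interiorC_smul (hc w) hu)]
    abel
  have map_pos : ∀ t > (0 : ℝ), ∀ v : X, G (t • v + c (t • v) • S.u) - G (c (t • v) • S.u) =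
      t • (G (v + c v • S.u) - G (c v • S.u)) := by
    intro t ht v
    have e : t • v + (t * c v) • S.u = t • (v + c v • S.u) := by module
    rw [key (t • v) (t * c v) (mul_pos ht (hc v)) (e ▸ S.interiorC_smul ht (hcv v)), e,
      hsmul t ht _ (hcv v), mul_smul, hsmul t ht _ (S.interiorC_smul (hc v) hu), smul_sub]
  let A : X →+ Y := AddMonoidHom.mk' (fun v => G (v + c v • S.u) - G (c v • S.u)) map_add
  have hA : ∀ t > (0 : ℝ), ∀ v, A (t • v) = t • A v := map_pos
  refine ⟨{ A with map_smul' := fun t v => ?_ }, fun x hx => ?_⟩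
  · change A (t • v) = t • A v
    rcases lt_trichotomy t 0 with ht | rfl | ht
    · have := hA (-t) (neg_pos.2 ht) v
      rwa [neg_smul, map_neg, neg_smul, neg_inj] at this
    · simp
    · exact hA t ht v
  · change G (x + c x • S.u) - G (c x • S.u) = G x
    rw [hadd x hx _ (S.interiorC_smul (hc x) hu), add_sub_cancel_right]

end OrderUnitSpace

section Isometry

variable {X₁ : Type*} [AddCommGroup X₁] [Module ℝ X₁] {X₂ : Type*} [AddCommGroup X₂] [Module ℝ X₂]

/-- If the image of the segment `[x, z]` under `f` is projective, the parameters of the three pairs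
formed by `x`, `z` and a point of the segment multiply to one. -/
lemma ProjOnSegment.cocycle_of_mem_segment {f : X₁ → X₂} {x y z : X₁} {ρ σ ω : ℝ}
    (h₁ : ProjOnSegment f x y ρ) (h₂ : ProjOnSegment f y z σ) (h₃ : ProjOnSegment f z x ω)
    (hxy : f x ≠ f y) (hyz : f y ≠ f z) (hy : y ∈ segment ℝ x z) : ρ * σ * ω = 1 := by
  obtain ⟨s, t, hs, ht, hst, rfl⟩ := hy
  have hω := h₃.1
  have e₁ := h₁.unique (h₃.symm.restrict hs ht hst) hxy
  have e₂ := h₂.symm.unique (ρ' := t + s * ω) (by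
    rw [add_comm (s • x)]
    exact h₃.restrict ht hs (by linarith)) hyz.symm
  have hd := denom_pos hω ht hs (by linarith)
  rw [e₁, ← inv_inv σ, e₂]
  field_simp
  ring

/-- The image of the centroid of a triangle lies on the image of each median. -/
lemma exists_map_centroid {f : X₁ → X₂} {x y z : X₁} {σ τ : ℝ} (hyz : ProjOnSegment f y z σ)
    (hm : ProjOnSegment f x ((1 / 2 : ℝ) • y + (1 / 2 : ℝ) • z) τ) :
    ∃ A B : ℝ, 0 < A ∧
      f ((1 / 3 : ℝ) • (x + y + z)) = A • f x + B • f y + (B * σ) • f z := by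
  have hσ := hyz.1
  have hτ := hm.1
  have e : (1 / 3 : ℝ) • (x + y + z) =
      (1 / 3 : ℝ) • x + (2 / 3 : ℝ) • ((1 / 2 : ℝ) • y + (1 / 2 : ℝ) • z) := by module
  refine ⟨(1 / 3 + 2 / 3 * τ)⁻¹ * (1 / 3),
    (1 / 3 + 2 / 3 * τ)⁻¹ * (2 / 3 * τ) * (1 / 2 + 1 / 2 * σ)⁻¹ * (1 / 2), by positivity, ?_⟩
  rw [e, hm.2 _ _ (by norm_num) (by norm_num) (by norm_num),
    hyz.2 _ _ (by norm_num) (by norm_num) (by norm_num)]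
  module

namespace IsStrictIsometry

variable {S₁ : OrderUnitSpace X₁} {S₂ : OrderUnitSpace X₂} {φ₁ : X₁ →ₗ[ℝ] ℝ} {φ₂ : X₂ →ₗ[ℝ] ℝ}
  {f : X₁ → X₂} (H : IsStrictIsometry S₁ S₂ φ₁ φ₂ f)

include H

lemma coeff_eq_zero {x y z : X₁} (hx : x ∈ S₁.Sig φ₁) (hy : y ∈ S₁.Sig φ₁)
    (hz : z ∈ S₁.Sig φ₁) (hc : ¬ Collinear ℝ {f x, f y, f z}) {a b c : ℝ}
    (h : a • f x + b • f y + c • f z = 0) : a = 0 ∧ b = 0 ∧ c = 0 := by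
  rw [← affineIndependent_iff_not_collinear_set, affineIndependent_iff] at hc
  have hsum : a + b + c = 0 := by
    simpa [(H.maps hx).2, (H.maps hy).2, (H.maps hz).2] using congrArg φ₂ h
  have := hc Finset.univ ![a, b, c] (by simpa [Fin.sum_univ_three] using hsum)
    (by simpa [Fin.sum_univ_three] using h)
  exact ⟨this 0 (Finset.mem_univ _), this 1 (Finset.mem_univ _), this 2 (Finset.mem_univ _)⟩

/-- The projective parameters on the sides of a triangle multiply to one (Ceva's theorem applied to
the medians). -/
lemma cocycle {x y z : X₁} (hx : x ∈ S₁.Sig φ₁) (hy : y ∈ S₁.Sig φ₁) (hz : z ∈ S₁.Sig φ₁)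
    (hxy : x ≠ y) (hyz : y ≠ z) (hzx : z ≠ x) {ρ σ ω : ℝ} (h₁ : ProjOnSegment f x y ρ)
    (h₂ : ProjOnSegment f y z σ) (h₃ : ProjOnSegment f z x ω) : ρ * σ * ω = 1 := by
  have nxy := H.map_ne hx hy hxy
  have nyz := H.map_ne hy hz hyz
  have nzx := H.map_ne hz hx hzx
  by_cases hc : Collinear ℝ {f x, f y, f z}
  · rcases hc.wbtw_or_wbtw_or_wbtw with h | h | h <;> rw [← mem_segment_iff_wbtw] at h
    · exact h₁.cocycle_of_mem_segment h₂ h₃ nxy nyz ((H.map_mem_segment_iff hx hz hy).1 h)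
    · rw [← h₂.cocycle_of_mem_segment h₃ h₁ nyz nzx ((H.map_mem_segment_iff hy hx hz).1 h)]
      ring
    · rw [← h₃.cocycle_of_mem_segment h₁ h₂ nzx nxy ((H.map_mem_segment_iff hz hy hx).1 h)]
      ring
  have mid : ∀ {v w : X₁}, v ∈ S₁.Sig φ₁ → w ∈ S₁.Sig φ₁ →
      (1 / 2 : ℝ) • v + (1 / 2 : ℝ) • w ∈ S₁.Sig φ₁ := fun hv hw =>
    Sig_combo hv hw (by norm_num) (by norm_num) (by norm_num)
  obtain ⟨τ₁, m₁⟩ := H.exists_projOnSegment hx (mid hy hz)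
  obtain ⟨τ₂, m₂⟩ := H.exists_projOnSegment hy (mid hz hx)
  obtain ⟨τ₃, m₃⟩ := H.exists_projOnSegment hz (mid hx hy)
  obtain ⟨A, B, hA, e₁⟩ := exists_map_centroid h₂ m₁
  obtain ⟨A', B', -, e₂⟩ := exists_map_centroid h₃ m₂
  obtain ⟨A'', B'', -, e₃⟩ := exists_map_centroid h₁ m₃
  rw [show y + z + x = x + y + z by abel, e₁] at e₂
  rw [show z + x + y = x + y + z by abel, e₁] at e₃
  have c₂ := H.coeff_eq_zero hx hy hz hc (a := A - B' * ω) (b := B - A') (c := B * σ - B') (by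
    rw [← sub_eq_zero] at e₂
    rw [← e₂]
    module)
  have c₃ := H.coeff_eq_zero hx hy hz hc (a := A - B'') (b := B - B'' * ρ) (c := B * σ - A'') (by
    rw [← sub_eq_zero] at e₃
    rw [← e₃]
    module)
  apply mul_left_cancel₀ hA.ne'
  linear_combination (ρ * σ * ω) * c₃.1 - (σ * ω) * c₃.2.1 + ω * c₂.2.2 - c₂.1

/-- On the cross section `f` becomes affine after multiplication by a suitable positive
function. -/
lemma exists_multiplier : ∃ l : X₁ → ℝ, (∀ x ∈ S₁.Sig φ₁, 0 < l x) ∧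
    ∀ x ∈ S₁.Sig φ₁, ∀ y ∈ S₁.Sig φ₁, ∀ s t : ℝ, 0 ≤ s → 0 ≤ t → s + t = 1 →
      l (s • x + t • y) • f (s • x + t • y) = s • l x • f x + t • l y • f y := by
  classical
  have hex : ∀ x y : X₁, ∃ ρ : ℝ, (x = y → ρ = 1) ∧
      (x ∈ S₁.Sig φ₁ → y ∈ S₁.Sig φ₁ → x ≠ y → ProjOnSegment f x y ρ) := by
    intro x y
    by_cases h : x ∈ S₁.Sig φ₁ ∧ y ∈ S₁.Sig φ₁ ∧ x ≠ y
    · obtain ⟨ρ, hρ⟩ := H.exists_projOnSegment h.1 h.2.1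
      exact ⟨ρ, fun h' => absurd h' h.2.2, fun _ _ _ => hρ⟩
    · exact ⟨1, fun _ => rfl, fun h₁ h₂ h₃ => absurd ⟨h₁, h₂, h₃⟩ h⟩
  choose r hr1 hr using hex
  have r_self : ∀ x, r x x = 1 := fun x => hr1 x x rfl
  have r_pos : ∀ x ∈ S₁.Sig φ₁, ∀ y ∈ S₁.Sig φ₁, 0 < r x y := by
    intro x hx y hy
    by_cases h : x = y
    · rw [hr1 x y h]
      exact one_pos
    · exact (hr x y hx hy h).1
  have r_symm : ∀ x ∈ S₁.Sig φ₁, ∀ y ∈ S₁.Sig φ₁, r x y * r y x = 1 := by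
    intro x hx y hy
    by_cases h : x = y
    · rw [hr1 x y h, hr1 y x h.symm, one_mul]
    · rw [(hr y x hy hx (Ne.symm h)).unique (hr x y hx hy h).symm (H.map_ne hy hx (Ne.symm h)),
        mul_inv_cancel₀ (r_pos x hx y hy).ne']
  have r_cocycle : ∀ x ∈ S₁.Sig φ₁, ∀ y ∈ S₁.Sig φ₁, ∀ z ∈ S₁.Sig φ₁,
      r x y * r y z = r x z := by
    intro x hx y hy z hz
    by_cases hxy : x = y
    · rw [hxy, r_self, one_mul]
    by_cases hyz : y = z
    · rw [hyz, r_self, mul_one]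
    by_cases hzx : z = x
    · rw [hzx, r_self, r_symm x hx y hy]
    have h1 := H.cocycle hx hy hz hxy hyz hzx (hr x y hx hy hxy) (hr y z hy hz hyz)
      (hr z x hz hx hzx)
    apply mul_right_cancel₀ (r_pos z hz x hx).ne'
    rw [h1, r_symm x hx z hz]
  have hu := unit_mem_Sig H.state₁
  refine ⟨r S₁.u, fun x hx => r_pos _ hu x hx, fun x hx y hy s t hs ht hst => ?_⟩
  by_cases hxy : x = y
  · subst hxy
    rw [← add_smul, ← add_smul, hst, one_smul, one_smul]
  have hw := Sig_combo hx hy hs ht hst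
  have hxyP := hr x y hx hy hxy
  have hrw : r x (s • x + t • y) = s + t * r x y := by
    by_cases h : x = s • x + t • y
    · have h0 : t • (y - x) = 0 := by
        have h' : s = 1 - t := by linarith
        rw [h', ← sub_eq_zero] at h
        rw [← neg_eq_zero, ← h]
        module
      have ht0 : t = 0 := (smul_eq_zero.1 h0).resolve_right (sub_ne_zero.2 (Ne.symm hxy))
      rw [hr1 _ _ h, ht0]
      linarith
    · exact (hr _ _ hx hw h).unique (hxyP.restrict hs ht hst) (H.map_ne hx hw h)
  have hd := ProjOnSegment.denom_pos hxyP.1 hs ht hst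
  rw [← r_cocycle _ hu x hx _ hw, ← r_cocycle _ hu x hx y hy, hrw, hxyP.2 s t hs ht hst]
  match_scalars <;> field_simp

/-- The linear map that induces the isometry, together with its positive scaling factor. -/
lemma exists_linearMap : ∃ T : X₁ →ₗ[ℝ] X₂, ∀ x ∈ S₁.Sig φ₁, ∃ l > (0 : ℝ), T x = l • f x := by
  obtain ⟨l, hl, hF⟩ := H.exists_multiplier
  have hφ : ∀ {x}, x ∈ S₁.interiorC → 0 < φ₁ x := fun hx => H.pos₁.pos_of_interior H.state₁ hx
  have hn : ∀ {x}, x ∈ S₁.interiorC → (φ₁ x)⁻¹ • x ∈ S₁.Sig φ₁ :=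
    fun hx => normalize_mem_Sig H.state₁ H.pos₁ hx
  obtain ⟨T, hT⟩ := S₁.exists_linearMap_extension
    (fun x => φ₁ x • l ((φ₁ x)⁻¹ • x) • f ((φ₁ x)⁻¹ • x)) (fun x hx y hy => by
      have hx' := hφ hx
      have hy' := hφ hy
      have e : (φ₁ (x + y))⁻¹ • (x + y) = (φ₁ x / (φ₁ x + φ₁ y)) • (φ₁ x)⁻¹ • x +
          (φ₁ y / (φ₁ x + φ₁ y)) • (φ₁ y)⁻¹ • y := by
        rw [map_add]
        match_scalars <;> field_simp
      simp only [e]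
      rw [hF _ (hn hx) _ (hn hy) _ _ (by positivity) (by positivity) (by field_simp), map_add]
      match_scalars <;> field_simp)
    (fun c hc x hx => by
      have hx' := hφ hx
      have e : (φ₁ (c • x))⁻¹ • c • x = (φ₁ x)⁻¹ • x := by
        rw [map_smul, smul_eq_mul]
        match_scalars
        field_simp
      simp only [e]
      rw [map_smul, smul_eq_mul, mul_smul])
  refine ⟨T, fun x hx => ⟨l x, hl x hx, ?_⟩⟩
  rw [hT x hx.1, hx.2]
  simp

end IsStrictIsometry

end Isometry

/-- If `Σ₁` and `Σ₂` are strictly convex Hilbert geometries (cross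
sections of order unit spaces with strictly positive states), then every isometry
`f : (Σ₁, d_H) → (Σ₂, d_H)` is a projective linear homomorphism: there is a bi-positive
linear map `T : X₁ → X₂` with `f x = T x / φ₂ (T x)` for all `x ∈ Σ₁`. -/
theorem isometry_strictly_convex_is_projective_linear
    {X₁ : Type*} [AddCommGroup X₁] [Module ℝ X₁]
    {X₂ : Type*} [AddCommGroup X₂] [Module ℝ X₂]
    (S₁ : OrderUnitSpace X₁) (S₂ : OrderUnitSpace X₂)
    (φ₁ : X₁ →ₗ[ℝ] ℝ) (φ₂ : X₂ →ₗ[ℝ] ℝ)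
    (hstate₁ : S₁.IsState φ₁) (hpos₁ : S₁.StrictlyPos φ₁)
    (hstate₂ : S₂.IsState φ₂) (hpos₂ : S₂.StrictlyPos φ₂)
    (hsc₁ : ∀ x ∈ S₁.relBoundary φ₁, ∀ y ∈ S₁.relBoundary φ₁, x ≠ y →
      openSegment ℝ x y ⊆ S₁.Sig φ₁)
    (hsc₂ : ∀ x ∈ S₂.relBoundary φ₂, ∀ y ∈ S₂.relBoundary φ₂, x ≠ y →
      openSegment ℝ x y ⊆ S₂.Sig φ₂)
    (f : X₁ → X₂) (hmaps : Set.MapsTo f (S₁.Sig φ₁) (S₂.Sig φ₂))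
    (hiso : ∀ x ∈ S₁.Sig φ₁, ∀ y ∈ S₁.Sig φ₁, S₂.dH (f x) (f y) = S₁.dH x y) :
    ∃ T : X₁ →ₗ[ℝ] X₂, (∀ x : X₁, T x ∈ S₂.C ↔ x ∈ S₁.C) ∧
      ∀ x ∈ S₁.Sig φ₁, f x = (φ₂ (T x))⁻¹ • T x := by
  have H : IsStrictIsometry S₁ S₂ φ₁ φ₂ f :=
    ⟨hstate₁, hpos₁, hstate₂, hpos₂, hsc₁, hsc₂, hmaps, hiso⟩
  obtain ⟨T, hT⟩ := H.exists_linearMap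
  have hTint : ∀ x ∈ S₁.interiorC, T x ∈ S₂.C := by
    intro x hx
    obtain ⟨l, hl, h⟩ := hT _ (normalize_mem_Sig hstate₁ hpos₁ hx)
    have h' := S₂.smul_mem hl.le
      (S₂.interiorC_subset (hmaps (normalize_mem_Sig hstate₁ hpos₁ hx)).1)
    rw [← h, map_smul] at h'
    exact S₂.mem_of_smul_mem (inv_pos.2 (hpos₁.pos_of_interior hstate₁ hx)) h'
  have hTpos : ∀ x ∈ S₁.C, T x ∈ S₂.C := by
    intro x hx
    refine S₂.mem_of_forall_add_smul_unit fun ε hε => ?_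
    obtain ⟨K, hK, hKm⟩ := S₂.orderUnit (T S₁.u)
    have h := hTint _ (S₁.interiorC_add
      (S₁.interiorC_smul (div_pos hε hK) S₁.unit_mem_interiorC) hx)
    rw [map_add, map_smul] at h
    convert S₂.add_mem h (S₂.smul_mem (div_pos hε hK).le hKm) using 1
    match_scalars <;> field_simp
    ring
  have hu := unit_mem_Sig (S := S₁) hstate₁
  obtain ⟨k, hk, hTu⟩ := hT _ hu
  refine ⟨T, fun x => ⟨fun hx => ?_, hTpos x⟩, fun x hx => ?_⟩
  · obtain ⟨K, hK, hKm⟩ := S₁.exists_add_mem x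
    have hw : (K + 1) • S₁.u + x ∈ S₁.interiorC := by
      convert S₁.interiorC_add S₁.unit_mem_interiorC hKm using 1
      module
    obtain ⟨w, hwS, c, hc, hxw⟩ : ∃ w ∈ S₁.Sig φ₁, ∃ c > (0 : ℝ),
        x = (K + 1) • (c • w - S₁.u) := by
      refine ⟨_, normalize_mem_Sig hstate₁ hpos₁ hw, φ₁ ((K + 1) • S₁.u + x) / (K + 1),
        div_pos (hpos₁.pos_of_interior hstate₁ hw) (by positivity), ?_⟩
      have := hpos₁.pos_of_interior hstate₁ hw
      generalize φ₁ ((K + 1) • S₁.u + x) = d at this ⊢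
      match_scalars <;> field_simp
      ring
    obtain ⟨l, hl, hTw⟩ := hT w hwS
    have a₁ := one_le_M hpos₁ hu hwS
    have a₂ := one_le_M hpos₁ hwS hu
    have b₁ := one_le_M hpos₂ (hmaps hu) (hmaps hwS)
    have b₂ := one_le_M hpos₂ (hmaps hwS) (hmaps hu)
    have hMM : S₂.M (f S₁.u) (f w) * S₂.M (f w) (f S₁.u) = S₁.M S₁.u w * S₁.M w S₁.u :=
      Real.log_injOn_pos (Set.mem_Ioi.2 (by positivity)) (Set.mem_Ioi.2 (by positivity))
        (hiso _ hu w hwS)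
    have i₁ : S₂.M (f w) (f S₁.u) ≤ S₁.M w S₁.u * k / l := by
      refine M_le (by positivity) ?_
      have h := hTpos _ (M_smul_sub_mem w hu.1)
      rw [map_sub, map_smul, hTu, hTw] at h
      convert S₂.smul_mem (inv_nonneg.2 hl.le) h using 1
      match_scalars <;> field_simp
    have i₂ : S₂.M (f S₁.u) (f w) ≤ c * l / k := by
      refine M_le (by positivity) ?_
      rw [hxw, map_smul, map_sub, map_smul, hTu, hTw] at hx
      have h := S₂.mem_of_smul_mem (by positivity) hx
      convert S₂.smul_mem (inv_nonneg.2 hk.le) h using 1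
      match_scalars <;> field_simp
    have hle : S₁.M S₁.u w ≤ c := by
      have h := mul_le_mul i₂ i₁ (by positivity) (by positivity)
      rw [hMM, show c * l / k * (S₁.M w S₁.u * k / l) = c * S₁.M w S₁.u by field_simp] at h
      exact le_of_mul_le_mul_right h (by positivity)
    rw [hxw]
    exact S₁.smul_mem (by positivity) (smul_sub_mem_of_M_le _ hwS.1 hle)
  · obtain ⟨l, hl, hTx⟩ := hT x hx
    rw [hTx, map_smul, (hmaps hx).2, smul_smul, smul_eq_mul, mul_one, inv_mul_cancel₀ hl.ne',
      one_smul]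

end HilbertGeom
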